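/- Let k ≥ 1 and r ≥ 2 be integers, n ≥ kr(k+r−2) + 2r − 1, and let H be the r-uniform hypergraph consisting of exactly k pairwise disjoint edges. If G is an r-graph on n vertices with φ_H^r(G) = φ_H^r(n), then e(G) ≥ C(n,r) − (k−1)·[C(n,r) − C(n−k+1, r)]. -/

import Mathlib

/-- `p` is a copy of the `r`-graph `H` consisting of exactly `k` pairwise disjoint edges:
a set of `k` pairwise disjoint edges. -/
def IsMatchingSet (k : ℕ) {n : ℕ} (p : Finset (Finset (Fin n))) : Prop :=
  p.card = k ∧ ∀ e ∈ p, ∀ f ∈ p, e ≠ f → Disjoint e f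

/-- A decomposition of the edge set `G` of an `r`-graph into parts `P`, where each part is
either a single edge or a copy of the `r`-graph `H` consisting of `k` pairwise disjoint
edges. -/
def IsMatchingDecomp (k : ℕ) {n : ℕ} (G : Finset (Finset (Fin n)))
    (P : Finset (Finset (Finset (Fin n)))) : Prop :=
  (∀ p ∈ P, ∀ q ∈ P, p ≠ q → Disjoint p q) ∧
    P.biUnion id = G ∧
    ∀ p ∈ P, (∃ e, p = {e}) ∨ IsMatchingSet k p

/-- `φ_H^r(G)`: the minimum number of parts in an `H`-decomposition of `G`, where `H`
consists of `k` pairwise disjoint edges. -/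
noncomputable def phiM (k : ℕ) {n : ℕ} (G : Finset (Finset (Fin n))) : ℕ :=
  sInf {m | ∃ P, IsMatchingDecomp k G P ∧ P.card = m}

/-- `φ_H^r(n)`: the maximum of `φ_H^r(G)` over all `r`-graphs `G` on `n` vertices. -/
noncomputable def phiMMax (r k n : ℕ) : ℕ :=
  sSup {m | ∃ G : Finset (Finset (Fin n)), (∀ e ∈ G, e.card = r) ∧ phiM k G = m}

/-- `F` contains no `k` pairwise disjoint sets. -/
def NoMatching (k : ℕ) (F : Set (Finset ℕ)) : Prop :=
  ∀ M : Fin k → Finset ℕ, (∀ t, M t ∈ F) → ¬ Pairwise (Function.onFun Disjoint M)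

/-- `F` is closed under replacing an element by a smaller one that is at least `a`. -/
def IsShifted (a : ℕ) (F : Set (Finset ℕ)) : Prop :=
  ∀ A ∈ F, ∀ i j, a ≤ i → i < j → j ∈ A → i ∉ A → insert i (A.erase j) ∈ F

lemma IsShifted.singleton_mem {a : ℕ} {F : Set (Finset ℕ)} (hF : IsShifted a F) {x y : ℕ}
    (hx : {x} ∈ F) (hay : a ≤ y) (hyx : y ≤ x) : {y} ∈ F := by
  rcases hyx.eq_or_lt with rfl | h
  · exact hx
  · have := hF _ hx y x hay h (by simp) (by simp; omega)
    simpa using this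

lemma IsShifted.noMatching_link {a m r s : ℕ} {F : Set (Finset ℕ)} (hF : IsShifted a F)
    (hM : NoMatching (s + 1) F) (hm : (s + 1) * (r + 1) ≤ m + 1) :
    NoMatching (s + 1)
      {A | A ∈ Finset.powersetCard r (Finset.Ico a (a + m)) ∧ insert (a + m) A ∈ F} := by
  intro B hB hd
  have hBc : (Finset.univ.biUnion B).card ≤ (s + 1) * r := by
    refine Finset.card_biUnion_le.trans ?_
    rw [Finset.sum_congr rfl fun t _ => (Finset.mem_powersetCard.1 (hB t).1).2]
    simp
  have hC : s + 1 ≤ (Finset.Ico a (a + m + 1) \ Finset.univ.biUnion B).card := by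
    have := Finset.le_card_sdiff (Finset.univ.biUnion B) (Finset.Ico a (a + m + 1))
    rw [Nat.card_Ico] at this
    have h2 : (s + 1) * (r + 1) = (s + 1) * r + (s + 1) := by ring
    omega
  obtain ⟨y⟩ : Nonempty (Fin (s + 1) ↪
      (Finset.Ico a (a + m + 1) \ Finset.univ.biUnion B : Finset ℕ)) := by
    apply Function.Embedding.nonempty_of_card_le
    simpa using hC
  have hy : ∀ t, a ≤ (y t : ℕ) ∧ (y t : ℕ) ≤ a + m ∧ ∀ u, (y t : ℕ) ∉ B u := by
    intro t
    have := (y t).2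
    simp only [Finset.mem_sdiff, Finset.mem_Ico, Finset.mem_biUnion, Finset.mem_univ, true_and,
      not_exists] at this
    exact ⟨this.1.1, by omega, this.2⟩
  refine hM (fun t => insert (y t : ℕ) (B t)) ?_ ?_
  · intro t
    obtain ⟨h1, h2, h3⟩ := hy t
    have hmem := (hB t).2
    have hnot : a + m ∉ B t := fun h => by
      have := (Finset.mem_powersetCard.1 (hB t).1).1 h
      simp at this
    rcases h2.eq_or_lt with h | h
    · simpa only [h] using hmem
    · have := hF _ hmem (y t) (a + m) h1 h (by simp) (by
        simp only [Finset.mem_insert, not_or]; exact ⟨h.ne, h3 t⟩)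
      rwa [Finset.erase_insert hnot] at this
  · intro t u htu
    have hne : (y t : ℕ) ≠ y u := fun h => htu (y.injective (Subtype.ext h))
    simp only [Function.onFun, Finset.disjoint_insert_left, Finset.disjoint_insert_right,
      Finset.mem_insert, not_or]
    exact ⟨⟨hne.symm, (hy u).2.2 t⟩, (hy t).2.2 u, hd htu⟩

open Classical in
lemma card_filter_mem_or_lt_le (s a m : ℕ) : ∀ (r : ℕ) (F : Set (Finset ℕ)), IsShifted a F →
    NoMatching (s + 1) F →
    ((Finset.powersetCard (r + 1) (Finset.Ico a (a + m))).filter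
      fun A => A ∈ F ∨ ∃ x ∈ A, x < a + s).card ≤ s * m.choose r := by
  have small : ∀ m r : ℕ, ∀ F : Set (Finset ℕ), m < (s + 1) * (r + 1) →
      ((Finset.powersetCard (r + 1) (Finset.Ico a (a + m))).filter
        fun A => A ∈ F ∨ ∃ x ∈ A, x < a + s).card ≤ s * m.choose r := by
    intro m r F h
    refine (Finset.card_filter_le _ _).trans ?_
    rw [Finset.card_powersetCard, Nat.card_Ico, Nat.add_sub_cancel_left]
    have h1 := Nat.choose_succ_right_eq m r
    have h2 : m - r ≤ s * (r + 1) := by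
      have : (s + 1) * (r + 1) = s * (r + 1) + (r + 1) := by ring
      omega
    refine Nat.le_of_mul_le_mul_right (?_ : _ * (r + 1) ≤ _ * (r + 1)) r.succ_pos
    calc _ = m.choose r * (m - r) := h1
      _ ≤ m.choose r * (s * (r + 1)) := Nat.mul_le_mul_left _ h2
      _ = _ := by ring
  induction m with
  | zero =>
    intro r F _ _
    exact small 0 r F (by positivity)
  | succ m ih =>
    intro r F hF hM
    rcases lt_or_ge (m + 1) ((s + 1) * (r + 1)) with h | h
    · exact small _ r F h
    cases r with
    | zero =>
      have hsub : ((Finset.powersetCard (0 + 1) (Finset.Ico a (a + (m + 1)))).filter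
          fun A => A ∈ F ∨ ∃ x ∈ A, x < a + s) ⊆
          (Finset.Ico a (a + s)).image fun x => ({x} : Finset ℕ) := by
        intro A hA
        rw [Finset.mem_filter, Finset.mem_powersetCard, Finset.card_eq_one] at hA
        obtain ⟨⟨hAs, x, rfl⟩, hA⟩ := hA
        have hx : a ≤ x := (Finset.mem_Ico.1 (hAs (Finset.mem_singleton_self x))).1
        refine Finset.mem_image.2 ⟨x, Finset.mem_Ico.2 ⟨hx, ?_⟩, rfl⟩
        rcases hA with hA | hA
        · by_contra! hlt
          refine hM (fun t => {a + (t : ℕ)}) (fun t => ?_) (fun t u htu => ?_)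
          · exact hF.singleton_mem hA (by omega) (by omega)
          · simp only [Function.onFun, Finset.disjoint_singleton]
            intro h
            exact htu (Fin.ext (by omega))
        · simpa using hA
      refine (Finset.card_le_card hsub).trans (Finset.card_image_le.trans ?_)
      simp
    | succ r =>
      have hsm : s ≤ m := by nlinarith
      have hI : Finset.Ico a (a + (m + 1)) = insert (a + m) (Finset.Ico a (a + m)) := by
        ext x; simp only [Finset.mem_Ico, Finset.mem_insert]; omega
      have hx : a + m ∉ Finset.Ico a (a + m) := by simp
      obtain ⟨F', hF'⟩ : ∃ F' : Set (Finset ℕ), F' =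
          {A | A ∈ Finset.powersetCard (r + 1) (Finset.Ico a (a + m)) ∧ insert (a + m) A ∈ F} :=
        ⟨_, rfl⟩
      have hshift : IsShifted a F' := by
        subst hF'
        rintro A ⟨hA, hAF⟩ i j hai hij hj hi
        rw [Finset.mem_powersetCard] at hA
        have hjm := Finset.mem_Ico.1 (hA.1 hj)
        refine ⟨Finset.mem_powersetCard.2 ⟨?_, ?_⟩, ?_⟩
        · intro y hy
          rcases Finset.mem_insert.1 hy with rfl | hy
          · exact Finset.mem_Ico.2 ⟨hai, by omega⟩
          · exact hA.1 (Finset.mem_of_mem_erase hy)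
        · rw [Finset.card_insert_of_notMem (by simp [hi]), Finset.card_erase_of_mem hj, hA.2]
          omega
        · have := hF _ hAF i j hai hij (by simp [hj]) (by simp [hi]; omega)
          rwa [Finset.erase_insert_of_ne (by omega), Finset.insert_comm] at this
      have h0 := ih (r + 1) F hF hM
      have h1 := ih r F' hshift (hF' ▸ hF.noMatching_link hM h)
      rw [hI, Finset.powersetCard_succ_insert hx, Finset.filter_union, Finset.filter_image]
      refine (Finset.card_union_le _ _).trans ?_
      refine (Nat.add_le_add h0 (Finset.card_image_le.trans
        ((Finset.card_le_card ?_).trans h1))).trans_eq ?_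
      · intro A hA
        rw [Finset.mem_filter] at hA ⊢
        refine ⟨hA.1, hA.2.imp (fun h => hF' ▸ ⟨hA.1, h⟩) ?_⟩
        rintro ⟨x, hx, hxs⟩
        rcases Finset.mem_insert.1 hx with rfl | hx
        · omega
        · exact ⟨x, hx, hxs⟩
      · rw [Nat.choose_succ_succ]
        ring

lemma choose_le_mul_add_choose_sub (m q : ℕ) : ∀ s, s + 1 ≤ m →
    m.choose (q + 1) ≤ (s + 1) * (m - 1).choose q + (m - (s + 1)).choose (q + 1) := by
  intro s
  induction s with
  | zero =>
    intro hs
    obtain ⟨m, rfl⟩ := Nat.exists_eq_add_of_le' hs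
    simp [Nat.choose_succ_succ]
  | succ s ih =>
    intro hs
    have h1 := ih (by omega)
    obtain ⟨d, rfl⟩ := Nat.exists_eq_add_of_le' hs
    have e1 : d + (s + 1 + 1) - (s + 1) = d + 1 := by omega
    have e2 : d + (s + 1 + 1) - (s + 1 + 1) = d := by omega
    rw [e1, Nat.choose_succ_succ] at h1
    rw [e2]
    have h2 : d.choose q ≤ (d + (s + 1 + 1) - 1).choose q := Nat.choose_le_choose q (by omega)
    nlinarith

lemma two_mul_choose_sub_lower (m q : ℕ) : ∀ s, s ≤ m →
    2 * (s * m.choose (q + 1)) + 2 * (m - s).choose (q + 2) ≤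
      2 * m.choose (q + 2) + s * (s + 1) * (m - 1).choose q := by
  intro s
  induction s with
  | zero => simp
  | succ s ih =>
    intro hs
    have h1 := ih (by omega)
    have h2 := choose_le_mul_add_choose_sub m q s hs
    have e : m - s = (m - (s + 1)) + 1 := by omega
    rw [e, Nat.choose_succ_succ] at h1
    nlinarith

lemma choose_sub_inequality (m q s : ℕ) (hm : (q + 1) * (s * (q + 2) + s + 1) ≤ m) :
    s * (s * (q + 2) * (m - 2).choose q) + s * m.choose (q + 1) + 2 * (m - s).choose (q + 2) ≤
      2 * m.choose (q + 2) := by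
  have hsm' : s * (q + 2) + s + 1 ≤ m := (Nat.le_mul_of_pos_left _ q.succ_pos).trans hm
  have hsm : s + 1 ≤ m := by linarith [Nat.zero_le (s * (q + 2))]
  have h1 := two_mul_choose_sub_lower m q s (by omega)
  have h2 : (m - 2).choose q ≤ (m - 1).choose q := Nat.choose_le_choose q (by omega)
  have h3 : (s * (q + 2) + s + 1) * (m - 1).choose q ≤ m.choose (q + 1) := by
    obtain ⟨d, rfl⟩ : ∃ d, m = d + 1 := Nat.exists_eq_add_of_le' (by omega)
    have := Nat.add_one_mul_choose_eq d q
    refine Nat.le_of_mul_le_mul_right (?_ : _ * (q + 1) ≤ _ * (q + 1)) q.succ_pos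
    rw [← this]
    calc _ = ((q + 1) * (s * (q + 2) + s + 1)) * d.choose q := by simp; ring
      _ ≤ _ := Nat.mul_le_mul_right _ hm
  have h4 : s * (s * (q + 2) * (m - 2).choose q) ≤ s * (s * (q + 2) * (m - 1).choose q) := by
    gcongr
  have h5 := Nat.mul_le_mul_left s h3
  nlinarith

lemma IsShifted.card_le_of_mem_or_lt {s a m r : ℕ} {F : Set (Finset ℕ)} (hF : IsShifted a F)
    (hM : NoMatching (s + 1) F) {K : Finset (Finset ℕ)}
    (hK : K ⊆ Finset.powersetCard (r + 1) (Finset.Ico a (a + m)))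
    (hKF : ∀ A ∈ K, A ∈ F ∨ ∃ x ∈ A, x < a + s) : K.card ≤ s * m.choose r := by
  classical
  exact (Finset.card_le_card fun A hA => Finset.mem_filter.2 ⟨hK hA, hKF A hA⟩).trans
    (card_filter_mem_or_lt_le s a m r F hF hM)

lemma card_filter_mem_le_mul_choose {a m q : ℕ} {F : Finset (Finset ℕ)}
    (hF : ∀ A ∈ F, A ∈ Finset.powersetCard (q + 2) (Finset.Ico a (a + m))) {U : Finset ℕ}
    (haU : a ∉ U) (hU : ∀ A ∈ F, a ∈ A → ¬ Disjoint A U) :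
    (F.filter fun A => a ∈ A).card ≤ U.card * (m - 2).choose q := by
  classical
  have hsub : (F.filter fun A => a ∈ A) ⊆
      U.biUnion fun u => F.filter fun A => a ∈ A ∧ u ∈ A := by
    intro A hA
    rw [Finset.mem_filter] at hA
    obtain ⟨u, huA, huU⟩ := Finset.not_disjoint_iff.1 (hU A hA.1 hA.2)
    exact Finset.mem_biUnion.2 ⟨u, huU, Finset.mem_filter.2 ⟨hA.1, hA.2, huA⟩⟩
  refine (Finset.card_le_card hsub).trans (Finset.card_biUnion_le_card_mul _ _ _ ?_)
  intro u hu
  have hau : a ≠ u := fun h => haU (h ▸ hu)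
  rcases (F.filter fun A => a ∈ A ∧ u ∈ A).eq_empty_or_nonempty with h | ⟨A₀, hA₀⟩
  · simp [h]
  have hA₀' := Finset.mem_filter.1 hA₀
  have hA₀I := (Finset.mem_powersetCard.1 (hF _ hA₀'.1)).1
  have hsub2 : (F.filter fun A => a ∈ A ∧ u ∈ A) ⊆
      (Finset.powersetCard q (((Finset.Ico a (a + m)).erase a).erase u)).image
        fun B => insert a (insert u B) := by
    intro A hA
    obtain ⟨hA, haA, huA⟩ := Finset.mem_filter.1 hA
    obtain ⟨hAI, hAc⟩ := Finset.mem_powersetCard.1 (hF A hA)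
    have huA' : u ∈ A.erase a := Finset.mem_erase.2 ⟨hau.symm, huA⟩
    refine Finset.mem_image.2 ⟨(A.erase a).erase u, Finset.mem_powersetCard.2 ⟨?_, ?_⟩, ?_⟩
    · exact Finset.erase_subset_erase _ (Finset.erase_subset_erase _ hAI)
    · rw [Finset.card_erase_of_mem huA', Finset.card_erase_of_mem haA, hAc]
      omega
    · rw [Finset.insert_erase huA', Finset.insert_erase haA]
  refine (Finset.card_le_card hsub2).trans (Finset.card_image_le.trans ?_)
  rw [Finset.card_powersetCard, Finset.card_erase_of_mem
    (Finset.mem_erase.2 ⟨hau.symm, hA₀I hA₀'.2.2⟩), Finset.card_erase_of_mem (hA₀I hA₀'.2.1),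
    Nat.card_Ico, Nat.add_sub_cancel_left, Nat.sub_sub]

lemma IsShifted.card_filter_mem_le {a v : ℕ} {F : Finset (Finset ℕ)}
    (hF : IsShifted a (F : Set (Finset ℕ))) (hav : a ≤ v) :
    (F.filter fun A => v ∈ A).card ≤ (F.filter fun A => a ∈ A).card := by
  rcases hav.eq_or_lt with rfl | hav
  · rfl
  refine Finset.card_le_card_of_injOn (fun A => if a ∈ A then A else insert a (A.erase v)) ?_ ?_
  · intro A hA
    simp only [Finset.coe_filter, Set.mem_ofPred_eq] at hA ⊢
    split_ifs with h
    · exact ⟨hA.1, h⟩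
    · exact ⟨hF A hA.1 a v le_rfl hav hA.2 h, Finset.mem_insert_self _ _⟩
  · intro A hA B hB hAB
    simp only [Finset.coe_filter, Set.mem_ofPred_eq] at hA hB
    simp only at hAB
    split_ifs at hAB with h1 h2 h2
    · exact hAB
    · have := hA.2
      rw [hAB] at this
      simp [hav.ne'] at this
    · have := hB.2
      rw [← hAB] at this
      simp [hav.ne'] at this
    · have h3 : A.erase v = B.erase v := by
        rw [← Finset.erase_insert (s := A.erase v) (a := a) (by simp [h1]), hAB,
          Finset.erase_insert (by simp [h2])]
      rw [← Finset.insert_erase hA.2, h3, Finset.insert_erase hB.2]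

lemma IsShifted.card_add_choose_le (q : ℕ) : ∀ (s a m : ℕ) (F : Finset (Finset ℕ)),
    (q + 1) * (s * (q + 2) + s + 1) ≤ m →
    (∀ A ∈ F, A ∈ Finset.powersetCard (q + 2) (Finset.Ico a (a + m))) →
    IsShifted a (F : Set (Finset ℕ)) → NoMatching (s + 1) (F : Set (Finset ℕ)) →
    F.card + (m - s).choose (q + 2) ≤ m.choose (q + 2) := by
  classical
  intro s
  induction s with
  | zero =>
    intro a m F _ _ _ hM
    have : F = ∅ := by
      refine Finset.eq_empty_of_forall_notMem fun A hA => hM (fun _ => A) (fun _ => hA) ?_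
      intro i j hij
      exact absurd (Subsingleton.elim (α := Fin 1) i j) hij
    simp [this]
  | succ s ih =>
    intro a m F hm hF hsh hM
    have hsm : (q + 1) * (s * (q + 2) + s + 1) + 1 ≤ m := by nlinarith
    obtain ⟨d, rfl⟩ : ∃ d, m = d + 1 := Nat.exists_eq_add_of_le' (by omega)
    by_cases hN : NoMatching (s + 1) ((F.filter fun A => a ∉ A : Finset _) : Set (Finset ℕ))
    · have hrest := ih (a + 1) d (F.filter fun A => a ∉ A) (by omega) (by
        intro A hA
        obtain ⟨hA, haA⟩ := Finset.mem_filter.1 hA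
        obtain ⟨hAI, hAc⟩ := Finset.mem_powersetCard.1 (hF A hA)
        refine Finset.mem_powersetCard.2 ⟨fun x hx => ?_, hAc⟩
        have h1 := Finset.mem_Ico.1 (hAI hx)
        have h2 : x ≠ a := fun h => haA (h ▸ hx)
        exact Finset.mem_Ico.2 ⟨by omega, by omega⟩) (by
        intro A hA i j hi hij hj hiA
        obtain ⟨hA, haA⟩ := Finset.mem_filter.1 hA
        refine Finset.mem_coe.2 (Finset.mem_filter.2 ⟨hsh A hA i j (by omega) hij hj hiA, ?_⟩)
        simp only [Finset.mem_insert, Finset.mem_erase, not_or, not_and]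
        exact ⟨by omega, fun _ => haA⟩) hN
      have hdeg : (F.filter fun A => a ∈ A).card ≤ d.choose (q + 1) := by
        have hsub : (F.filter fun A => a ∈ A) ⊆
            (Finset.powersetCard (q + 1) ((Finset.Ico a (a + (d + 1))).erase a)).image
              (insert a) := by
          intro A hA
          obtain ⟨hA, haA⟩ := Finset.mem_filter.1 hA
          obtain ⟨hAI, hAc⟩ := Finset.mem_powersetCard.1 (hF A hA)
          refine Finset.mem_image.2 ⟨A.erase a, Finset.mem_powersetCard.2
            ⟨Finset.erase_subset_erase _ hAI, ?_⟩, Finset.insert_erase haA⟩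
          rw [Finset.card_erase_of_mem haA, hAc]
          omega
        refine (Finset.card_le_card hsub).trans (Finset.card_image_le.trans ?_)
        rw [Finset.card_powersetCard, Finset.card_erase_of_mem (by simp), Nat.card_Ico,
          Nat.add_sub_cancel_left, Nat.add_sub_cancel]
      have hsplit := Finset.card_filter_add_card_filter_not (s := F) (fun A => a ∈ A)
      have e : d + 1 - (s + 1) = d - s := by omega
      have e' : (d + 1).choose (q + 2) = d.choose (q + 1) + d.choose (q + 2) :=
        Nat.choose_succ_succ' d (q + 1)
      rw [e, e']
      omega
    · simp only [NoMatching, not_forall, not_not] at hN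
      obtain ⟨M, hMF, hMd⟩ := hN
      have hMF' : ∀ t, M t ∈ F ∧ a ∉ M t := fun t => by simpa using hMF t
      set U := Finset.univ.biUnion M with hU
      have hUc : U.card ≤ (s + 1) * (q + 2) := by
        refine Finset.card_biUnion_le.trans ?_
        rw [Finset.sum_congr rfl fun t _ => (Finset.mem_powersetCard.1 (hF _ (hMF' t).1)).2]
        simp
      have hdeg : (F.filter fun A => a ∈ A).card ≤ (s + 1) * (q + 2) * (d + 1 - 2).choose q := by
        refine (card_filter_mem_le_mul_choose hF (U := U) ?_ ?_).trans
          (Nat.mul_le_mul_right _ hUc)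
        · simp [hU, fun t => (hMF' t).2]
        · intro A hA _ hAU
          rw [hU, Finset.disjoint_biUnion_right] at hAU
          refine hM (Fin.cons A M) (fun t => ?_) ?_
          · refine Fin.cases ?_ (fun t => ?_) t
            · simpa using hA
            · simpa using (hMF' t).1
          · intro t u
            refine Fin.cases ?_ (fun t => ?_) t <;> refine Fin.cases ?_ (fun u => ?_) u
            · simp
            · intro _
              simpa [Function.onFun] using hAU u (Finset.mem_univ _)
            · intro _
              simpa [Function.onFun] using (hAU t (Finset.mem_univ _)).symm
            · intro htu
              simpa [Function.onFun] using hMd (fun h => htu (congrArg Fin.succ h))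
      have hhit : (F.filter fun A => ∃ x ∈ A, x < a + (s + 1)).card ≤
          (s + 1) * ((s + 1) * (q + 2) * (d + 1 - 2).choose q) := by
        have hsub : (F.filter fun A => ∃ x ∈ A, x < a + (s + 1)) ⊆
            (Finset.Ico a (a + (s + 1))).biUnion fun v => F.filter fun A => v ∈ A := by
          intro A hA
          obtain ⟨hA, x, hx, hxs⟩ := Finset.mem_filter.1 hA
          have := Finset.mem_Ico.1 ((Finset.mem_powersetCard.1 (hF A hA)).1 hx)
          exact Finset.mem_biUnion.2 ⟨x, Finset.mem_Ico.2 ⟨this.1, hxs⟩,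
            Finset.mem_filter.2 ⟨hA, hx⟩⟩
        refine (Finset.card_le_card hsub).trans ?_
        refine (Finset.card_biUnion_le_card_mul _ _ _ fun v hv =>
          (hsh.card_filter_mem_le (Finset.mem_Ico.1 hv).1).trans hdeg).trans ?_
        simp
      set K := Finset.powersetCard (q + 1 + 1) (Finset.Ico a (a + (d + 1))) with hK
      have hKc : K.card = (d + 1).choose (q + 2) := by
        rw [hK, Finset.card_powersetCard, Nat.card_Ico, Nat.add_sub_cancel_left]
      have hmiss : (K.filter fun A => ¬ ∃ x ∈ A, x < a + (s + 1)).card ≤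
          (d + 1 - (s + 1)).choose (q + 2) := by
        have hsub : (K.filter fun A => ¬ ∃ x ∈ A, x < a + (s + 1)) ⊆
            Finset.powersetCard (q + 2) (Finset.Ico (a + (s + 1)) (a + (d + 1))) := by
          intro A hA
          obtain ⟨hA, hx⟩ := Finset.mem_filter.1 hA
          push Not at hx
          obtain ⟨hAI, hAc⟩ := Finset.mem_powersetCard.1 hA
          exact Finset.mem_powersetCard.2 ⟨fun x hxA => Finset.mem_Ico.2
            ⟨hx x hxA, (Finset.mem_Ico.1 (hAI hxA)).2⟩, hAc⟩
        refine (Finset.card_le_card hsub).trans ?_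
        rw [Finset.card_powersetCard, Nat.card_Ico, Nat.add_sub_add_left]
      have hsplitK := Finset.card_filter_add_card_filter_not (s := K)
        (fun A => ∃ x ∈ A, x < a + (s + 1))
      have hsplitF := Finset.card_filter_add_card_filter_not (s := F)
        (fun A => ∃ x ∈ A, x < a + (s + 1))
      have hunion : (K.filter fun A => ∃ x ∈ A, x < a + (s + 1)).card +
          (F.filter fun A => ¬ ∃ x ∈ A, x < a + (s + 1)).card ≤
          (s + 1) * (d + 1).choose (q + 1) := by
        rw [← Finset.card_union_of_disjoint]
        · refine hsh.card_le_of_mem_or_lt hM (Finset.union_subset (Finset.filter_subset _ _)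
            fun A hA => hF A (Finset.mem_filter.1 hA).1) fun A hA => ?_
          rcases Finset.mem_union.1 hA with hA | hA
          · exact Or.inr (Finset.mem_filter.1 hA).2
          · exact Or.inl (Finset.mem_filter.1 hA).1
        · rw [Finset.disjoint_left]
          intro A hA hA'
          exact (Finset.mem_filter.1 hA').2 (Finset.mem_filter.1 hA).2
      have hnum := choose_sub_inequality (d + 1) q (s + 1) hm
      omega

lemma uvCompress_singleton (i j : ℕ) (A : Finset ℕ) :
    UV.compress {i} {j} A = if i ∉ A ∧ j ∈ A then insert i A \ {j} else A := by
  simp [UV.compress, Finset.union_singleton]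

lemma insert_sdiff_eq_map_swap {i j : ℕ} {A : Finset ℕ} (hi : i ∉ A) (hj : j ∈ A) :
    insert i A \ {j} = A.map (Equiv.swap i j).toEmbedding := by
  have hij : i ≠ j := fun h => hi (h ▸ hj)
  ext x
  rw [Finset.mem_map_equiv, Equiv.symm_swap]
  simp only [Finset.mem_sdiff, Finset.mem_insert, Finset.mem_singleton]
  by_cases h1 : x = i
  · subst h1; simp [hij, hj]
  · by_cases h2 : x = j
    · subst h2; simp [hi]
    · simp [Equiv.swap_apply_of_ne_of_ne h1 h2, h1, h2]

lemma map_swap_eq_self {i j : ℕ} {A : Finset ℕ} (h : i ∈ A ↔ j ∈ A) :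
    A.map (Equiv.swap i j).toEmbedding = A := by
  ext x
  rw [Finset.mem_map_equiv, Equiv.symm_swap]
  by_cases h1 : x = i
  · subst h1; simp [h]
  · by_cases h2 : x = j
    · subst h2; simp [h]
    · rw [Equiv.swap_apply_of_ne_of_ne h1 h2]

lemma map_swap_map_swap (i j : ℕ) (A : Finset ℕ) :
    (A.map (Equiv.swap i j).toEmbedding).map (Equiv.swap i j).toEmbedding = A := by
  ext x
  simp [Finset.mem_map_equiv]

lemma NoMatching.compression {k : ℕ} {F : Finset (Finset ℕ)}
    (hF : NoMatching k (F : Set (Finset ℕ))) (i j : ℕ) :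
    NoMatching k (UV.compression {i} {j} F : Set (Finset ℕ)) := by
  intro M hM hd
  by_cases hall : ∀ t, M t ∈ F
  · exact hF M hall hd
  push Not at hall
  obtain ⟨t₀, ht₀⟩ := hall
  have key : ∀ t, M t ∉ F → i ∈ M t ∧ j ∉ M t ∧
      (M t).map (Equiv.swap i j).toEmbedding ∈ F := by
    intro t ht
    rcases UV.mem_compression.1 (hM t) with h | ⟨-, B, hB, hBt⟩
    · exact absurd h.1 ht
    · rw [uvCompress_singleton] at hBt
      split_ifs at hBt with h
      · have hij : i ≠ j := fun e => h.1 (e ▸ h.2)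
        rw [← hBt]
        refine ⟨by simp [hij], by simp, ?_⟩
        rw [insert_sdiff_eq_map_swap h.1 h.2, map_swap_map_swap]
        exact hB
      · exact absurd (hBt ▸ hB) ht
  obtain ⟨hi₀, hj₀, hs₀⟩ := key t₀ ht₀
  refine hF (fun t => (M t).map (Equiv.swap i j).toEmbedding) (fun t => ?_) ?_
  · rcases eq_or_ne t t₀ with rfl | htt
    · exact hs₀
    have hit : i ∉ M t := fun h => Finset.disjoint_left.1 (hd htt) h hi₀
    have htF : M t ∈ F := by
      by_contra h
      exact hit (key t h).1
    by_cases hjt : j ∈ M t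
    · rcases UV.mem_compression.1 (hM t) with h | h
      · have := h.2
        rw [uvCompress_singleton, if_pos ⟨hit, hjt⟩, insert_sdiff_eq_map_swap hit hjt] at this
        exact this
      · exact absurd htF h.1
    · rw [map_swap_eq_self (iff_of_false hit hjt)]
      exact htF
  · intro t u htu
    exact (Finset.disjoint_map _).2 (hd htu)

lemma sum_uvCompress_lt {i j : ℕ} (hij : i < j) {A : Finset ℕ} (hi : i ∉ A) (hj : j ∈ A) :
    ∑ x ∈ UV.compress {i} {j} A, x < ∑ x ∈ A, x := by
  rw [uvCompress_singleton, if_pos ⟨hi, hj⟩, Finset.sdiff_singleton_eq_erase,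
    Finset.erase_insert_of_ne hij.ne, Finset.sum_insert (by simp [hi]),
    ← Finset.add_sum_erase A _ hj]
  omega

lemma sum_compression_lt {i j : ℕ} (hij : i < j) {F : Finset (Finset ℕ)} {A : Finset ℕ}
    (hA : A ∈ F) (hi : i ∉ A) (hj : j ∈ A) (hs : UV.compress {i} {j} A ∉ F) :
    ∑ B ∈ UV.compression {i} {j} F, ∑ x ∈ B, x < ∑ B ∈ F, ∑ x ∈ B, x := by
  rw [UV.compression, Finset.sum_union UV.compress_disjoint, Finset.filter_image,
    Finset.sum_image UV.compress_injOn,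
    ← Finset.sum_filter_add_sum_filter_not F (fun B => UV.compress {i} {j} B ∈ F)]
  refine Nat.add_lt_add_left (Finset.sum_lt_sum (fun B hB => ?_)
    ⟨A, Finset.mem_filter.2 ⟨hA, hs⟩, sum_uvCompress_lt hij hi hj⟩) _
  by_cases h : i ∉ B ∧ j ∈ B
  · exact (sum_uvCompress_lt hij h.1 h.2).le
  · rw [uvCompress_singleton, if_neg h]

lemma exists_isShifted {r n k : ℕ} (F : Finset (Finset ℕ))
    (hF : ∀ A ∈ F, A ∈ Finset.powersetCard r (Finset.Ico 0 n))
    (hM : NoMatching k (F : Set (Finset ℕ))) :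
    ∃ F' : Finset (Finset ℕ), F'.card = F.card ∧
      (∀ A ∈ F', A ∈ Finset.powersetCard r (Finset.Ico 0 n)) ∧
      IsShifted 0 (F' : Set (Finset ℕ)) ∧ NoMatching k (F' : Set (Finset ℕ)) := by
  induction h : ∑ B ∈ F, ∑ x ∈ B, x using Nat.strong_induction_on generalizing F with
  | _ w ih =>
    by_cases hsh : IsShifted 0 (F : Set (Finset ℕ))
    · exact ⟨F, rfl, hF, hsh, hM⟩
    simp only [IsShifted, not_forall] at hsh
    obtain ⟨A, hA, i, j, -, hij, hj, hi, hnot⟩ := hsh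
    have hs : UV.compress {i} {j} A ∉ F := by
      rw [uvCompress_singleton, if_pos ⟨hi, hj⟩, Finset.sdiff_singleton_eq_erase,
        Finset.erase_insert_of_ne hij.ne]
      exact hnot
    obtain ⟨F', hc, hF', hsh', hM'⟩ := ih _ (h ▸ sum_compression_lt hij hA hi hj hs)
      (UV.compression {i} {j} F) (by
        intro B hB
        rcases UV.mem_compression.1 hB with h | ⟨-, C, hC, rfl⟩
        · exact hF B h.1
        · obtain ⟨hCI, hCc⟩ := Finset.mem_powersetCard.1 (hF C hC)
          refine Finset.mem_powersetCard.2 ⟨?_, ?_⟩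
          · rw [uvCompress_singleton]
            split_ifs with h
            · have hjn := Finset.mem_Ico.1 (hCI h.2)
              refine Finset.sdiff_subset.trans (Finset.insert_subset ?_ hCI)
              exact Finset.mem_Ico.2 ⟨by omega, by omega⟩
            · exact hCI
          · rw [UV.card_compress (by simp), hCc]) (hM.compression i j) rfl
    exact ⟨F', hc.trans (UV.card_compression _ _ _), hF', hsh', hM'⟩

/-- The Erdős matching theorem: an `r`-graph on `n` vertices without `s + 1` pairwise disjoint
edges has at most as many edges as the `r`-graph of all edges meeting a fixed `s`-set. -/
theorem card_add_choose_le_of_no_matching {n r s : ℕ} (hr : 2 ≤ r)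
    (hn : (r - 1) * (s * r + s + 1) ≤ n) (G : Finset (Finset (Fin n)))
    (hG : ∀ e ∈ G, e.card = r) (hM : ∀ p ⊆ G, ¬ IsMatchingSet (s + 1) p) :
    G.card + (n - s).choose r ≤ n.choose r := by
  classical
  obtain ⟨q, rfl⟩ := Nat.exists_eq_add_of_le' hr
  let f : Finset (Fin n) ↪ Finset ℕ := Finset.mapEmbedding Fin.valEmbedding |>.toEmbedding
  have hcard : (G.map f).card = G.card := Finset.card_map f
  obtain ⟨F, hFc, hF, hsh, hFM⟩ := exists_isShifted (r := q + 2) (n := n) (k := s + 1) (G.map f)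
    (by
      intro A hA
      obtain ⟨e, he, rfl⟩ := Finset.mem_map.1 hA
      refine Finset.mem_powersetCard.2 ⟨?_, ?_⟩
      · intro x hx
        obtain ⟨y, -, rfl⟩ := Finset.mem_map.1 hx
        exact Finset.mem_Ico.2 ⟨Nat.zero_le _, y.2⟩
      · exact (Finset.card_map _).trans (hG e he))
    (by
      intro M hMG hd
      have hMG' : ∀ t, ∃ e ∈ G, f e = M t := fun t => Finset.mem_map.1 (hMG t)
      choose E hE hEM using hMG'
      have hdE : ∀ t u, t ≠ u → Disjoint (E t) (E u) := by
        intro t u htu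
        have := hd htu
        simp only [Function.onFun, ← hEM] at this
        exact (Finset.disjoint_map _).1 this
      have hinj : Function.Injective E := by
        intro t u htu
        by_contra hne
        have h1 := hdE t u hne
        rw [htu, Finset.disjoint_self_iff_empty] at h1
        have h2 := hG _ (hE u)
        simp [h1] at h2
      refine hM (Finset.univ.image E) ?_ ⟨?_, ?_⟩
      · intro e he
        obtain ⟨t, -, rfl⟩ := Finset.mem_image.1 he
        exact hE t
      · rw [Finset.card_image_of_injective _ hinj, Finset.card_fin]
      · intro e he e' he' hne
        obtain ⟨t, -, rfl⟩ := Finset.mem_image.1 he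
        obtain ⟨u, -, rfl⟩ := Finset.mem_image.1 he'
        exact hdE t u fun h => hne (congrArg E h))
  rw [← hcard, ← hFc]
  exact hsh.card_add_choose_le q s 0 n F hn (by simpa using hF) hFM

lemma exists_isMatchingDecomp (s X : ℕ) {n : ℕ} (G : Finset (Finset (Fin n)))
    (hX : ∀ G' ⊆ G, (∀ p ⊆ G', ¬ IsMatchingSet (s + 1) p) → G'.card ≤ X) :
    ∃ P, IsMatchingDecomp (s + 1) G P ∧ (s + 1) * P.card ≤ G.card + s * X := by
  classical
  induction h : G.card using Nat.strong_induction_on generalizing G with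
  | _ c ih =>
    subst h
    by_cases hM : ∀ p ⊆ G, ¬ IsMatchingSet (s + 1) p
    · refine ⟨G.image fun e => {e}, ⟨?_, ?_, ?_⟩, ?_⟩
      · intro p hp q hq hpq
        obtain ⟨e, -, rfl⟩ := Finset.mem_image.1 hp
        obtain ⟨e', -, rfl⟩ := Finset.mem_image.1 hq
        exact Finset.disjoint_singleton.2 fun h => hpq (h ▸ rfl)
      · ext e
        simp
      · intro p hp
        obtain ⟨e, -, rfl⟩ := Finset.mem_image.1 hp
        exact Or.inl ⟨e, rfl⟩
      · rw [Finset.card_image_of_injective _ Finset.singleton_injective]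
        have := Nat.mul_le_mul_left s (hX G subset_rfl hM)
        linarith
    · push Not at hM
      obtain ⟨p, hpG, hp⟩ := hM
      have hcard := Finset.card_sdiff_add_card_eq_card hpG
      have hpc := hp.1
      obtain ⟨P, ⟨hP1, hP2, hP3⟩, hPc⟩ := ih (G \ p).card (by omega) (G \ p)
        (fun G' hG' => hX G' (hG'.trans Finset.sdiff_subset)) rfl
      have hdisj : ∀ q ∈ P, Disjoint p q := by
        intro q hq
        have : q ⊆ G \ p := hP2 ▸ Finset.subset_biUnion_of_mem id hq
        exact (Finset.disjoint_sdiff).mono_right this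
      refine ⟨insert p P, ⟨?_, ?_, ?_⟩, ?_⟩
      · intro a ha b hb hab
        rcases Finset.mem_insert.1 ha with rfl | ha' <;>
          rcases Finset.mem_insert.1 hb with rfl | hb'
        · exact absurd rfl hab
        · exact hdisj b hb'
        · exact (hdisj a ha').symm
        · exact hP1 a ha' b hb' hab
      · rw [Finset.biUnion_insert, hP2]
        exact Finset.union_sdiff_of_subset hpG
      · intro a ha
        rcases Finset.mem_insert.1 ha with rfl | ha
        · exact Or.inr hp
        · exact hP3 a ha
      · have := Finset.card_insert_le p P
        nlinarith

lemma IsMatchingDecomp.card_le {k n : ℕ} (hk : 1 ≤ k) {G : Finset (Finset (Fin n))}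
    {P : Finset (Finset (Finset (Fin n)))} (hP : IsMatchingDecomp k G P) :
    G.card ≤ k * P.card := by
  rw [← hP.2.1, mul_comm]
  refine Finset.card_biUnion_le_card_mul _ _ _ fun p hp => ?_
  rcases hP.2.2 p hp with ⟨e, rfl⟩ | h
  · simpa using hk
  · exact h.1.le

lemma exists_isMatchingDecomp_card_eq_phiM {k n : ℕ} (hk : 1 ≤ k)
    (G : Finset (Finset (Fin n))) : ∃ P, IsMatchingDecomp k G P ∧ P.card = phiM k G := by
  obtain ⟨s, rfl⟩ := Nat.exists_eq_add_of_le' hk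
  obtain ⟨P, hP, -⟩ := exists_isMatchingDecomp s G.card G fun G' hG' _ =>
    Finset.card_le_card hG'
  exact Nat.sInf_mem (s := {m | ∃ P, IsMatchingDecomp (s + 1) G P ∧ P.card = m}) ⟨_, P, hP, rfl⟩

lemma phiM_le_phiMMax {r k n : ℕ} (G : Finset (Finset (Fin n))) (hG : ∀ e ∈ G, e.card = r) :
    phiM k G ≤ phiMMax r k n := by
  refine le_csSup (Set.Finite.bddAbove ?_) ⟨G, hG, rfl⟩
  refine (Set.finite_range fun G : Finset (Finset (Fin n)) => phiM k G).subset ?_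
  rintro m ⟨G', -, rfl⟩
  exact ⟨G', rfl⟩

/-- For `k ≥ 1`, `r ≥ 2`, `n ≥ kr(k+r-2) + 2r - 1`, and `H` the `r`-graph consisting of
exactly `k` pairwise disjoint edges: if `G` is an `r`-graph on `n` vertices with
`φ_H^r(G) = φ_H^r(n)`, then `e(G) ≥ C(n,r) - (k-1)·[C(n,r) - C(n-k+1,r)]`. -/
theorem extremal_card_lower_bound (k r n : ℕ) (hk : 1 ≤ k) (hr : 2 ≤ r)
    (hn : k * r * (k + r - 2) + 2 * r - 1 ≤ n)
    (G : Finset (Finset (Fin n))) (hG : ∀ e ∈ G, e.card = r)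
    (hext : phiM k G = phiMMax r k n) :
    (n.choose r : ℤ) -
        ((k : ℤ) - 1) * ((n.choose r : ℤ) - ((n - k + 1).choose r : ℤ)) ≤
      (G.card : ℤ) := by
  obtain ⟨s, rfl⟩ := Nat.exists_eq_add_of_le' hk
  have hbig : (r - 1) * (s * r + s + 1) ≤ n := by
    obtain ⟨q, rfl⟩ := Nat.exists_eq_add_of_le' hr
    have e1 : s + 1 + (q + 2) - 2 = s + q + 1 := by omega
    have e2 : q + 2 - 1 = q + 1 := by omega
    rw [e1] at hn
    rw [e2]
    have h := Nat.sub_le_iff_le_add.1 hn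
    nlinarith [Nat.zero_le (s * q), Nat.zero_le (s * s * q), Nat.zero_le (s * s)]
  have hsn : s + 1 ≤ n := by
    obtain ⟨q, rfl⟩ := Nat.exists_eq_add_of_le' hr
    refine le_trans ?_ hbig
    rw [show q + 2 - 1 = q + 1 by omega]
    nlinarith [Nat.zero_le (s * q), Nat.zero_le (s * q * q)]
  have hsub : n - (s + 1) + 1 = n - s := by omega
  obtain ⟨P, hP, hPc⟩ := exists_isMatchingDecomp s (n.choose r - (n - s).choose r) G (by
    intro G' hG' hM
    have := card_add_choose_le_of_no_matching hr hbig G' (fun e he => hG e (hG' he)) hM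
    omega)
  obtain ⟨Q, hQ, hQc⟩ := exists_isMatchingDecomp_card_eq_phiM hk
    (Finset.powersetCard r (Finset.univ : Finset (Fin n)))
  have h1 := hQ.card_le hk
  rw [Finset.card_powersetCard, Finset.card_fin, hQc] at h1
  have h2 := phiM_le_phiMMax (k := s + 1) (Finset.powersetCard r (Finset.univ : Finset (Fin n)))
    fun e he => (Finset.mem_powersetCard.1 he).2
  have h3 : phiM (s + 1) G ≤ P.card := Nat.sInf_le ⟨P, hP, rfl⟩
  have h4 : n.choose r ≤ G.card + s * (n.choose r - (n - s).choose r) :=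
    (h1.trans (Nat.mul_le_mul_left _ (h2.trans (hext ▸ h3)))).trans hPc
  have h5 : (n - s).choose r ≤ n.choose r := Nat.choose_le_choose r (Nat.sub_le n s)
  rw [hsub]
  zify [h5] at h4
  push_cast
  linarith
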